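/- Let n ≥ 7 and let G and H be simple graphs on n vertices that share n−1 cards. If the average degree of G is at most n/4 − 1 (equivalently, if 4·∑_{v∈V(G)} deg(v,G) ≤ n·(n−4)), then for every integer r ≥ 1 we have κ_r(G) = κ_r(H). -/

import Mathlib

open SimpleGraph

/-- `kappa G r` is the number of `r`-cliques of the graph `G`. -/
noncomputable def kappa {V : Type*} (G : SimpleGraph V) (r : ℕ) : ℕ :=
  (G.cliqueSet r).ncard

/-- `degR G r v` is the number of `r`-cliques of `G` that contain the vertex `v`. -/
noncomputable def degR {V : Type*} (G : SimpleGraph V) (r : ℕ) (v : V) : ℕ :=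
  {s | s ∈ G.cliqueSet r ∧ v ∈ s}.ncard

/-- `deg G v` is the degree of the vertex `v` in `G`. -/
noncomputable def deg {V : Type*} (G : SimpleGraph V) (v : V) : ℕ :=
  (G.neighborSet v).ncard

/-- `gcard G v` is the card `G - v`: the induced subgraph of `G` on `V(G) \ {v}`. -/
def gcard {V : Type*} (G : SimpleGraph V) (v : V) : SimpleGraph {x : V // x ≠ v} :=
  G.induce {x : V | x ≠ v}

/-- The maximum degree `Δ(G)`. -/
noncomputable def maxDeg {n : ℕ} (G : SimpleGraph (Fin n)) : ℕ :=
  Finset.univ.sup (fun v => deg G v)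

/-- The minimum degree `δ(G)`. -/
noncomputable def minDeg {n : ℕ} (G : SimpleGraph (Fin n)) : ℕ :=
  sInf (Set.range (fun v => deg G v))

/-- `ℓ(G)`: the number of vertices of maximum degree. -/
noncomputable def numMaxDeg {n : ℕ} (G : SimpleGraph (Fin n)) : ℕ :=
  (Finset.univ.filter (fun v => deg G v = maxDeg G)).card

/-- `G` and `H` share `n-1` cards via the vertices `u`, `w` and the bijection `π`:
for every `v ≠ u`, the card `G - v` is isomorphic to the card `H - π(v)`. -/
def ShareCardsVia {n : ℕ} (G H : SimpleGraph (Fin n)) (u w : Fin n)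
    (π : {x : Fin n // x ≠ u} ≃ {y : Fin n // y ≠ w}) : Prop :=
  ∀ v : {x : Fin n // x ≠ u}, Nonempty (gcard G v.1 ≃g gcard H (π v).1)

/-- `G` and `H` share `n-1` cards. -/
def ShareCards {n : ℕ} (G H : SimpleGraph (Fin n)) : Prop :=
  ∃ (u w : Fin n) (π : {x : Fin n // x ≠ u} ≃ {y : Fin n // y ≠ w}),
    ShareCardsVia G H u w π


section CliqueCount
open Classical Finset

/-- number of `r`-cliques -/
noncomputable def kp {n : ℕ} (G : SimpleGraph (Fin n)) (r : ℕ) : ℕ :=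
  #{s : Finset (Fin n) | G.IsNClique r s}

/-- number of `r`-cliques containing `x` -/
noncomputable def dR {n : ℕ} (G : SimpleGraph (Fin n)) (r : ℕ) (x : Fin n) : ℕ :=
  #{s : Finset (Fin n) | G.IsNClique r s ∧ x ∈ s}

/-- number of `r`-cliques avoiding `v` -/
noncomputable def kA {n : ℕ} (G : SimpleGraph (Fin n)) (r : ℕ) (v : Fin n) : ℕ :=
  #{s : Finset (Fin n) | G.IsNClique r s ∧ v ∉ s}

/-- number of `r`-cliques containing `x` and avoiding `v` -/
noncomputable def cN {n : ℕ} (G : SimpleGraph (Fin n)) (r : ℕ) (v x : Fin n) : ℕ :=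
  #{s : Finset (Fin n) | G.IsNClique r s ∧ x ∈ s ∧ v ∉ s}

variable {n : ℕ}

lemma kappa_eq (G : SimpleGraph (Fin n)) (r : ℕ) : kappa G r = kp G r := by
  unfold kappa kp
  rw [← Set.ncard_coe_finset]
  congr 1
  ext s
  simp [SimpleGraph.mem_cliqueSet_iff]

lemma kp_split (G : SimpleGraph (Fin n)) (r : ℕ) (v : Fin n) : kp G r = kA G r v + dR G r v := by
  unfold kp kA dR
  rw [← Finset.card_filter_add_card_filter_not (p := fun s => v ∉ s), filter_filter, filter_filter]
  simp

lemma sum_dR (G : SimpleGraph (Fin n)) (r : ℕ) : ∑ v, dR G r v = r * kp G r := by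
  unfold dR kp
  simp_rw [Finset.card_filter]
  rw [Finset.sum_comm, Finset.mul_sum]
  apply Finset.sum_congr rfl
  intro s _
  by_cases h : G.IsNClique r s
  · simp [h, h.card_eq]
  · simp [h]

lemma cN_le (G : SimpleGraph (Fin n)) (r : ℕ) (v x : Fin n) : cN G r v x ≤ dR G r x := by
  unfold cN dR
  apply Finset.card_le_card
  intro s; simp; tauto

lemma cN_eq (G : SimpleGraph (Fin n)) (r : ℕ) (v x : Fin n) (hne : x ≠ v) (h : ¬ G.Adj v x) :
    cN G r v x = dR G r x := by
  unfold cN dR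
  congr 1
  ext s; simp
  intro hs hx hv
  exact h (hs.isClique hv hx hne.symm)

lemma two_iff (G : SimpleGraph (Fin n)) (s : Finset (Fin n)) :
    G.IsNClique 2 s ↔ ∃ a b, G.Adj a b ∧ s = {a, b} := by
  rw [SimpleGraph.isNClique_iff, Finset.card_eq_two]
  constructor
  · rintro ⟨h, a, b, hab, rfl⟩
    exact ⟨a, b, h (by simp) (by simp) hab, rfl⟩
  · rintro ⟨a, b, hab, rfl⟩
    refine ⟨?_, a, b, hab.ne, rfl⟩
    intro x hx y hy hxy
    simp at hx hy
    rcases hx with rfl | rfl <;> rcases hy with rfl | rfl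
    · exact absurd rfl hxy
    · exact hab
    · exact hab.symm
    · exact absurd rfl hxy

lemma dR_two (G : SimpleGraph (Fin n)) (x : Fin n) : dR G 2 x = #{y | G.Adj x y} := by
  unfold dR
  symm
  apply Finset.card_bij (fun y _ => ({x, y} : Finset (Fin n)))
  · intro y hy
    simp at hy
    simp [two_iff]
    exact ⟨x, y, hy, rfl⟩
  · intro y hy z hz h
    simp at hy hz
    have : y ∈ ({x, z} : Finset (Fin n)) := by rw [← h]; simp
    simp at this
    rcases this with h1 | h1
    · exact absurd h1 hy.ne'
    · exact h1
  · intro s hs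
    simp [two_iff] at hs
    obtain ⟨⟨a, b, hab, rfl⟩, hx⟩ := hs
    simp at hx
    rcases hx with rfl | rfl
    · exact ⟨b, by simpa using hab, rfl⟩
    · exact ⟨a, by simpa using hab.symm, by simp [Finset.pair_comm]⟩

lemma deg_eq (G : SimpleGraph (Fin n)) (x : Fin n) : deg G x = dR G 2 x := by
  rw [dR_two, deg, ← Set.ncard_coe_finset]
  congr 1
  ext y; simp

lemma cN_adj (G : SimpleGraph (Fin n)) (v x : Fin n) (h : G.Adj v x) :
    cN G 2 v x + 1 = dR G 2 x := by
  have hs : dR G 2 x = cN G 2 v x + #{s : Finset (Fin n) | G.IsNClique 2 s ∧ x ∈ s ∧ v ∈ s} := by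
    unfold dR cN
    rw [← Finset.card_filter_add_card_filter_not (p := fun s => v ∉ s), filter_filter, filter_filter]
    simp [and_assoc]
  rw [hs]
  congr 1
  symm
  rw [Finset.card_eq_one]
  refine ⟨{v, x}, ?_⟩
  ext s
  simp [two_iff]
  constructor
  · rintro ⟨⟨a, b, hab, rfl⟩, hx, hv⟩
    simp at hx hv
    rcases hx with rfl | rfl <;> rcases hv with rfl | rfl
    · exact absurd rfl h.ne
    · exact Finset.pair_comm _ _
    · rfl
    · exact absurd rfl h.ne
  · rintro rfl
    exact ⟨⟨v, x, h, rfl⟩, by simp, by simp⟩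

lemma dR_dom (G : SimpleGraph (Fin n)) (r : ℕ) (x : Fin n) (h : ∀ y, y ≠ x → G.Adj x y) :
    dR G (r + 1) x = kA G r x := by
  unfold dR kA
  symm
  apply Finset.card_bij (fun s _ => insert x s)
  · intro s hs
    simp at hs ⊢
    exact hs.1.insert (fun b hb => h b (fun hbx => hs.2 (hbx ▸ hb)))
  · intro s hs t ht hst
    simp at hs ht
    rw [← Finset.erase_insert hs.2, ← Finset.erase_insert ht.2, hst]
  · intro s hs
    simp at hs
    refine ⟨s.erase x, ?_, Finset.insert_erase hs.2⟩
    simp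
    exact hs.1.erase_of_mem hs.2

lemma dR_dom2 (G : SimpleGraph (Fin n)) (r : ℕ) (x p : Fin n) (hpx : p ≠ x) (hp : ¬ G.Adj x p)
    (h : ∀ y, y ≠ x → y ≠ p → G.Adj x y) :
    dR G (r + 1) x + dR G r p = kA G r x := by
  have hs : kA G r x = #{s : Finset (Fin n) | G.IsNClique r s ∧ x ∉ s ∧ p ∉ s} + dR G r p := by
    unfold kA dR
    rw [← Finset.card_filter_add_card_filter_not (p := fun s => p ∉ s), filter_filter, filter_filter]
    congr 2
    · ext s; simp [and_assoc]
    · ext s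
      simp only [mem_filter, mem_univ, true_and, not_not]
      constructor
      · tauto
      · rintro ⟨h1, h2⟩
        exact ⟨⟨h1, fun hx => hp (h1.isClique hx h2 hpx.symm)⟩, h2⟩
  rw [hs]
  congr 1
  unfold dR
  symm
  apply Finset.card_bij (fun s _ => insert x s)
  · intro s hs
    simp at hs ⊢
    exact hs.1.insert (fun b hb => h b (fun hbx => hs.2.1 (hbx ▸ hb)) (fun hbx => hs.2.2 (hbx ▸ hb)))
  · intro s hs t ht hst
    simp at hs ht
    rw [← Finset.erase_insert hs.2.1, ← Finset.erase_insert ht.2.1, hst]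
  · intro s hs
    simp at hs
    refine ⟨s.erase x, ?_, Finset.insert_erase hs.2⟩
    simp
    refine ⟨hs.1.erase_of_mem hs.2, fun hpx' hps => ?_⟩
    exact hp (hs.1.isClique hs.2 hps hpx.symm)

lemma dR_pos_deg (G : SimpleGraph (Fin n)) (r : ℕ) (x : Fin n) (h : 0 < dR G r x) :
    r ≤ dR G 2 x + 1 := by
  unfold dR at h
  rw [Finset.card_pos] at h
  obtain ⟨s, hs⟩ := h
  simp at hs
  have h1 : (s.erase x).card ≤ dR G 2 x := by
    rw [dR_two]
    apply Finset.card_le_card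
    intro y hy
    simp at hy ⊢
    exact hs.1.isClique hs.2 hy.2 (Ne.symm hy.1)
  rw [Finset.card_erase_of_mem hs.2, hs.1.card_eq] at h1
  omega

/-- sharing data, all in terms of permutations -/
def Sh (G H : SimpleGraph (Fin n)) (u w : Fin n) (σ : Equiv.Perm (Fin n)) : Prop :=
  σ u = w ∧ ∀ v, v ≠ u → ∃ e : Equiv.Perm (Fin n), e v = σ v ∧
    (∀ x, x ≠ v → ∀ r, cN G r v x = cN H r (σ v) (e x)) ∧ ∀ r, kA G r v = kA H r (σ v)

lemma Sh.symm {G H : SimpleGraph (Fin n)} {u w : Fin n} {σ : Equiv.Perm (Fin n)}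
    (h : Sh G H u w σ) : Sh H G w u σ.symm := by
  obtain ⟨h1, h2⟩ := h
  refine ⟨by simp [← h1], fun v hv => ?_⟩
  have hv' : σ.symm v ≠ u := by
    intro hh; apply hv; rw [← h1, ← hh]; simp
  obtain ⟨e, he, hc, hk⟩ := h2 _ hv'
  simp at he hc hk
  refine ⟨e.symm, ?_, fun x hx r => ?_, fun r => (hk r).symm⟩
  · rw [Equiv.symm_apply_eq]; exact he.symm
  · have := hc (e.symm x) (by intro hh; apply hx; rw [← he, ← hh]; simp) r
    simpa using this.symm

lemma perm_of_subtype {u w : Fin n} (π : {x : Fin n // x ≠ u} ≃ {y : Fin n // y ≠ w}) :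
    ∃ σ : Equiv.Perm (Fin n), σ u = w ∧ ∀ v : {x : Fin n // x ≠ u}, σ v.1 = (π v).1 := by
  refine ⟨π.extendSubtype, ?_, fun v => ?_⟩
  · have := π.extendSubtype_not_mem u (by simp)
    simpa using this
  · exact π.extendSubtype_apply_of_mem v.1 v.2

lemma isNClique_transfer {G H : SimpleGraph (Fin n)} {v v' : Fin n}
    (φ : gcard G v ≃g gcard H v') (e : Equiv.Perm (Fin n)) 
    (he : ∀ x : {x : Fin n // x ≠ v}, e x.1 = (φ x).1) (r : ℕ) (s : Finset (Fin n)) (hs : v ∉ s) :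
    G.IsNClique r s ↔ H.IsNClique r (s.map e.toEmbedding) := by
  have key : ∀ x y, x ≠ v → y ≠ v → (G.Adj x y ↔ H.Adj (e x) (e y)) := by
    intro x y hx hy
    have := φ.map_rel_iff' (a := ⟨x, hx⟩) (b := ⟨y, hy⟩)
    have h1 := he ⟨x, hx⟩
    have h2 := he ⟨y, hy⟩
    simp only at h1 h2
    rw [h1, h2]
    exact this.symm
  rw [SimpleGraph.isNClique_iff, SimpleGraph.isNClique_iff, Finset.card_map]
  apply and_congr_left
  intro _
  rw [SimpleGraph.isClique_iff, SimpleGraph.isClique_iff]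
  constructor
  · intro h a ha b hb hab
    rw [Finset.mem_coe, Finset.mem_map] at ha hb
    obtain ⟨a, ha, rfl⟩ := ha
    obtain ⟨b, hb, rfl⟩ := hb
    simp only [Equiv.coe_toEmbedding] at *
    rw [← key _ _ (fun hh => hs (hh ▸ ha)) (fun hh => hs (hh ▸ hb))]
    exact h ha hb (fun hh => hab (by rw [hh]))
  · intro h a ha b hb hab
    rw [key _ _ (fun hh => hs (hh ▸ ha)) (fun hh => hs (hh ▸ hb))]
    exact h (by simpa using ha) (by simpa using hb) (by simpa using hab)

lemma sh_of_shareCards (G H : SimpleGraph (Fin n)) (h : ShareCards G H) :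
    ∃ u w σ, Sh G H u w σ := by
  obtain ⟨u, w, π, hπ⟩ := h
  obtain ⟨σ, hσ1, hσ2⟩ := perm_of_subtype π
  refine ⟨u, w, σ, hσ1, fun v hv => ?_⟩
  obtain ⟨φ⟩ := hπ ⟨v, hv⟩
  rw [← hσ2 ⟨v, hv⟩] at φ
  simp only at φ
  obtain ⟨e, he1, he2⟩ := perm_of_subtype φ.toEquiv
  have htr := isNClique_transfer φ e he2
  refine ⟨e, he1, fun x hx r => ?_, fun r => ?_⟩
  · unfold cN
    apply Finset.card_equiv (e.finsetCongr)
    intro s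
    simp [Equiv.finsetCongr_apply, ← he1]
    exact fun _ h3 => htr r s h3
  · unfold kA
    apply Finset.card_equiv (e.finsetCongr)
    intro s
    simp [Equiv.finsetCongr_apply, ← he1]
    exact fun h3 => htr r s h3

lemma Sh.shift {G H : SimpleGraph (Fin n)} {u w : Fin n} {σ : Equiv.Perm (Fin n)}
    (h : Sh G H u w σ) (r : ℕ) (v : Fin n) (hv : v ≠ u) :
    (dR G r v : ℤ) = dR H r (σ v) + ((kp G r : ℤ) - kp H r) := by
  obtain ⟨e, _, _, hk⟩ := h.2 v hv
  have h1 := kp_split G r v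
  have h2 := kp_split H r (σ v)
  have := hk r
  omega

lemma Sh.shift_u {G H : SimpleGraph (Fin n)} {u w : Fin n} {σ : Equiv.Perm (Fin n)}
    (h : Sh G H u w σ) (r : ℕ) :
    ((n : ℤ) - 1 - r) * ((kp G r : ℤ) - kp H r) = dR H r w - dR G r u := by
  have h1 : ∑ v, (dR G r v : ℤ) = r * kp G r := by exact_mod_cast sum_dR G r
  have h2 : ∑ v, (dR H r v : ℤ) = r * kp H r := by exact_mod_cast sum_dR H r
  rw [← Equiv.sum_comp σ] at h2
  rw [← Finset.add_sum_erase _ _ (Finset.mem_univ u)] at h1 h2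
  have h3 : ∑ v ∈ univ.erase u, (dR G r v : ℤ)
      = ∑ v ∈ univ.erase u, (dR H r (σ v) : ℤ) + ((n:ℤ) - 1) * ((kp G r : ℤ) - kp H r) := by
    rw [Finset.sum_congr rfl (fun v hv => h.shift r v (Finset.ne_of_mem_erase hv)),
      Finset.sum_add_distrib]
    have : 0 < n := Fin.pos u
    simp only [sum_const, card_erase_of_mem (mem_univ u), card_univ, Fintype.card_fin,
      nsmul_eq_mul]
    rw [Nat.cast_sub (by omega)]
    simp
  rw [h.1] at h2
  linarith

lemma Sh.count {G H : SimpleGraph (Fin n)} {u w : Fin n} {σ : Equiv.Perm (Fin n)}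
    (h : Sh G H u w σ) (r : ℕ) (P : ℕ → ℕ → Prop) (v : Fin n) (hv : v ≠ u) :
    #{x | x ≠ v ∧ P (cN G 2 v x) (cN G r v x)}
      = #{y | y ≠ σ v ∧ P (cN H 2 (σ v) y) (cN H r (σ v) y)} := by
  obtain ⟨e, he, hc, _⟩ := h.2 v hv
  apply Finset.card_equiv e
  intro x
  simp only [mem_filter, mem_univ, true_and]
  by_cases hx : x = v
  · subst hx; simp [he]
  · have : e x ≠ σ v := by rw [← he]; simpa using hx
    simp [hx, this, hc x hx]

lemma Sh.sum_count {G H : SimpleGraph (Fin n)} {u w : Fin n} {σ : Equiv.Perm (Fin n)}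
    (h : Sh G H u w σ) (F F' : Fin n → ℕ) (hF : ∀ v, v ≠ u → F v = F' (σ v)) :
    ∑ v, F v + F' w = ∑ v, F' v + F u := by
  rw [← Equiv.sum_comp σ F', ← Finset.add_sum_erase _ _ (Finset.mem_univ u),
    ← Finset.add_sum_erase _ (fun v => F' (σ v)) (Finset.mem_univ u), h.1,
    Finset.sum_congr rfl (fun v hv => hF v (Finset.ne_of_mem_erase hv))]
  omega

lemma nonadj_card (G : SimpleGraph (Fin n)) (x : Fin n) :
    #{v | v ≠ x ∧ ¬ G.Adj v x} + dR G 2 x + 1 = n := by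
  have h1 : #(univ.filter (fun v : Fin n => ¬ (v ≠ x ∧ ¬ G.Adj v x))) = dR G 2 x + 1 := by
    rw [dR_two, ← Finset.card_insert_of_notMem (a := x) (by simp)]
    congr 1
    ext y
    simp [SimpleGraph.adj_comm]
    tauto
  have h2 := Finset.card_filter_add_card_filter_not (s := univ)
    (p := fun v : Fin n => (v ≠ x ∧ ¬ G.Adj v x))
  rw [h1] at h2
  simp only [card_univ, Fintype.card_fin] at h2
  omega

lemma kelly (G : SimpleGraph (Fin n)) (k : ℕ) :
    ∑ v, #{x | x ≠ v ∧ k ≤ cN G 2 v x}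
      = (n - 1) * #{x | k + 1 ≤ dR G 2 x} + (n - 1 - k) * #{x | dR G 2 x = k} := by
  simp_rw [Finset.card_filter]
  rw [Finset.sum_comm, Finset.mul_sum, Finset.mul_sum, ← Finset.sum_add_distrib]
  apply Finset.sum_congr rfl
  intro x _
  rw [← Finset.card_filter]
  have h1 := nonadj_card G x
  have hc : ∀ v, v ≠ x → (G.Adj v x → cN G 2 v x + 1 = dR G 2 x) ∧
      (¬ G.Adj v x → cN G 2 v x = dR G 2 x) :=
    fun v hv => ⟨cN_adj G v x, cN_eq G 2 v x hv.symm⟩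
  rcases lt_trichotomy k (dR G 2 x) with hk | hk | hk
  · rw [if_pos (by omega), if_neg (by omega)]
    have : (univ.filter fun v => x ≠ v ∧ k ≤ cN G 2 v x) = univ.erase x := by
      ext v
      simp only [mem_filter, mem_univ, true_and, mem_erase, and_true]
      constructor
      · exact fun h => h.1.symm
      · intro h
        refine ⟨h.symm, ?_⟩
        have := hc v h
        by_cases ha : G.Adj v x
        · have := this.1 ha; omega
        · have := this.2 ha; omega
    rw [this]; simp
  · rw [if_neg (by omega), if_pos (by omega)]
    have : (univ.filter fun v => x ≠ v ∧ k ≤ cN G 2 v x) = univ.filter (fun v => v ≠ x ∧ ¬ G.Adj v x) := by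
      ext v
      simp only [mem_filter, mem_univ, true_and]
      constructor
      · rintro ⟨h, h'⟩
        refine ⟨h.symm, fun ha => ?_⟩
        have := (hc v h.symm).1 ha; omega
      · rintro ⟨h, h'⟩
        refine ⟨h.symm, ?_⟩
        have := (hc v h).2 h'; omega
    rw [this]; omega
  · rw [if_neg (by omega), if_neg (by omega)]
    simp
    intro v hv
    exact lt_of_le_of_lt (cN_le G 2 v x) hk

lemma sum_two (G : SimpleGraph (Fin n)) (w z : Fin n) (hwz : w ≠ z) :
    2 * (dR G 2 w + dR G 2 z) ≤ ∑ x, dR G 2 x + 2 := by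
  have h1 : dR G 2 w + dR G 2 z = ∑ x, ((if G.Adj w x then 1 else 0) + (if G.Adj z x then 1 else 0)) := by
    rw [Finset.sum_add_distrib, dR_two, dR_two, Finset.card_filter, Finset.card_filter]
  have h2 : ∀ x, ((if G.Adj w x then 1 else 0) + (if G.Adj z x then 1 else 0)
      + (if x = w then dR G 2 w else 0) + (if x = z then dR G 2 z else 0))
      ≤ dR G 2 x + (if x = w then 1 else 0) + (if x = z then 1 else 0) := by
    intro x
    by_cases hxw : x = w
    · subst hxw
      simp [hwz]; split_ifs <;> omega
    by_cases hxz : x = z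
    · subst hxz
      simp [hwz.symm]; split_ifs <;> omega
    simp only [hxw, hxz, if_false, add_zero]
    have : #(({w, z} : Finset (Fin n)).filter (fun y => G.Adj x y)) ≤ dR G 2 x := by
      rw [dR_two]
      apply Finset.card_le_card
      intro y; simp
    rw [Finset.card_filter, Finset.sum_pair hwz] at this
    simpa [SimpleGraph.adj_comm] using this
  have h3 := Finset.sum_le_sum (fun x (_ : x ∈ univ) => h2 x)
  simp only [Finset.sum_add_distrib, Finset.sum_ite_eq', Finset.mem_univ, if_true] at h3 h1
  omega

lemma edge_eq {G H : SimpleGraph (Fin n)} {u w : Fin n} {σ : Equiv.Perm (Fin n)}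
    (h : Sh G H u w σ) (hsh : ∀ v, v ≠ u → dR G 2 v = dR H 2 (σ v) + 1)
    (k : ℕ) (hk1 : dR G 2 u < k) (hk2 : k + 1 ≤ dR H 2 w) (hkn : k + 2 ≤ n) :
    (n - 2 - k : ℤ) * #{x | dR G 2 x = k} + (k - 1) * #{x | dR G 2 x = k + 1}
      + #{x | x ≠ w ∧ ¬ H.Adj w x ∧ dR H 2 x = k} + #{x | G.Adj u x ∧ dR G 2 x = k} = n - 1 := by
  have hsum := h.sum_count (fun v => #{x | x ≠ v ∧ k ≤ cN G 2 v x})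
    (fun v => #{x | x ≠ v ∧ k ≤ cN H 2 v x}) (fun v hv => by
      have := h.count 2 (fun a _ => k ≤ a) v hv
      convert this)
  rw [kelly, kelly] at hsum
  have hT : #{x | k + 1 ≤ dR G 2 x} = #{x | k + 2 ≤ dR G 2 x} + #{x | dR G 2 x = k + 1} := by
    rw [← Finset.card_union_of_disjoint]
    · congr 1; ext x; simp; omega
    · rw [Finset.disjoint_filter]; intros; omega
  have hTH : #{x | k + 1 ≤ dR H 2 x} = #{x | k + 2 ≤ dR G 2 x} + 1 := by
    have : #{x | k + 2 ≤ dR G 2 x} = #((univ.filter fun x => k + 1 ≤ dR H 2 x).erase w) := by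
      apply Finset.card_equiv σ
      intro x
      simp only [mem_filter, mem_univ, true_and, mem_erase]
      by_cases hx : x = u
      · subst hx; simp [h.1]; omega
      · have h1 := hsh x hx
        have h2 : σ x ≠ w := by rw [← h.1]; simpa using hx
        simp [h2]; omega
    rw [this, Finset.card_erase_add_one]
    simpa using hk2
  have haH : #{x | dR H 2 x = k} = #{x | dR G 2 x = k + 1} := by
    symm
    apply Finset.card_equiv σ
    intro x
    simp only [mem_filter, mem_univ, true_and]
    by_cases hx : x = u
    · subst hx; rw [h.1]; omega
    · have h1 := hsh x hx
      omega
  have hFG : #{x | x ≠ u ∧ k ≤ cN G 2 u x} + #{x | G.Adj u x ∧ dR G 2 x = k}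
      = #{x | k + 1 ≤ dR G 2 x} + #{x | dR G 2 x = k} := by
    rw [← Finset.card_union_of_disjoint, ← Finset.card_union_of_disjoint]
    · congr 1; ext x
      simp only [mem_union, mem_filter, mem_univ, true_and]
      by_cases hx : x = u
      · subst hx; simp; omega
      · by_cases ha : G.Adj u x
        · have := cN_adj G u x ha
          simp [hx, ha]; omega
        · have := cN_eq G 2 u x hx ha
          simp [hx, ha]; omega
    · rw [Finset.disjoint_filter]; intros; omega
    · rw [Finset.disjoint_filter]
      rintro x _ ⟨h1, h2⟩ ⟨h3, h4⟩
      have := cN_adj G u x h3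
      omega
  have hFH : #{x | x ≠ w ∧ k ≤ cN H 2 w x} + 1 = #{x | k + 1 ≤ dR H 2 x} 
      + #{x | x ≠ w ∧ ¬ H.Adj w x ∧ dR H 2 x = k} := by
    rw [← Finset.card_union_of_disjoint, ← Finset.card_insert_of_notMem (a := w) (by simp)]
    · congr 1; ext x
      simp only [mem_union, mem_insert, mem_filter, mem_univ, true_and]
      by_cases hx : x = w
      · subst hx; simp; omega
      · by_cases ha : H.Adj w x
        · have := cN_adj H w x ha
          simp [hx, ha]; omega
        · have := cN_eq H 2 w x hx ha
          simp [hx, ha]; omega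
    · rw [Finset.disjoint_filter]; intros; omega
  generalize #{x | x ≠ w ∧ k ≤ cN H 2 w x} = fH at *
  generalize #{x | x ≠ u ∧ k ≤ cN G 2 u x} = fG at *
  generalize #{x | x ≠ w ∧ ¬ H.Adj w x ∧ dR H 2 x = k} = ε at *
  generalize #{x | G.Adj u x ∧ dR G 2 x = k} = ε' at *
  generalize #{x | k + 1 ≤ dR H 2 x} = tH at *
  generalize #{x | k + 1 ≤ dR G 2 x} = tG at *
  generalize #{x | k + 2 ≤ dR G 2 x} = tG2 at *
  generalize #{x | dR H 2 x = k} = aH at *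
  generalize #{x | dR G 2 x = k} = aG at *
  generalize #{x | dR G 2 x = k + 1} = aG1 at *
  zify at hsum hT hTH haH hFG hFH
  rw [Nat.cast_sub (show k ≤ n - 1 by omega), Nat.cast_sub (show 1 ≤ n by omega)] at hsum
  push_cast at hsum
  rw [hTH, haH, hT] at hsum
  rw [hTH] at hFH
  rw [hT] at hFG
  linarith

lemma edge_case {G H : SimpleGraph (Fin n)} {u w : Fin n} {σ : Equiv.Perm (Fin n)} (hn : 7 ≤ n)
    (h : Sh G H u w σ) (hD : (kp G 2 : ℤ) - kp H 2 = 1)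
    (hs : 4 * ∑ v, dR H 2 v ≤ n * (n - 4)) : False := by
  have hsh : ∀ v, v ≠ u → dR G 2 v = dR H 2 (σ v) + 1 := by
    intro v hv
    have := h.shift 2 v hv
    omega
  have hu : dR H 2 w + 3 = dR G 2 u + n := by
    have := h.shift_u 2
    rw [hD] at this
    push_cast at this
    omega
  have hw := nonadj_card H w
  have hn14 : 14 ≤ n := by
    obtain ⟨v, hv⟩ : ∃ v : Fin n, v ≠ u := by
      have : Nontrivial (Fin n) := Fin.nontrivial_iff_two_le.2 (by omega)
      exact exists_ne u
    obtain ⟨e, he, hc, _⟩ := h.2 v hv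
    have hwv : w ≠ σ v := by rw [← h.1]; simpa using hv.symm
    have hyv : e.symm w ≠ v := by
      intro hh; apply hwv; rw [← he, ← hh]; simp
    have h1 := hc _ hyv 2
    simp only [Equiv.apply_symm_apply] at h1
    have h2 := cN_le G 2 v (e.symm w)
    have h3 : dR H 2 w ≤ cN H 2 (σ v) w + 1 := by
      by_cases ha : H.Adj (σ v) w
      · rw [cN_adj H _ _ ha]
      · rw [cN_eq H 2 _ _ hwv ha]; omega
    have hyu : e.symm w ≠ u := by
      intro hh; rw [hh] at h2 h1; omega
    have h4 := hsh _ hyu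
    have h5 := sum_two H w (σ (e.symm w)) (by
      intro hh; apply hyu; apply σ.injective; rw [← hh, h.1])
    obtain ⟨m, rfl⟩ : ∃ m, n = m + 4 := ⟨n - 4, by omega⟩
    simp only [Nat.add_sub_cancel] at hs
    by_contra hlt
    have : m ≤ 9 := by omega
    interval_cases m <;> omega
  have e3 := edge_eq h hsh 3 (by omega) (by omega) (by omega)
  have e4 := edge_eq h hsh 4 (by omega) (by omega) (by omega)
  have e5 := edge_eq h hsh 5 (by omega) (by omega) (by omega)
  have hε : #{x | x ≠ w ∧ ¬ H.Adj w x ∧ dR H 2 x = 3} + #{x | x ≠ w ∧ ¬ H.Adj w x ∧ dR H 2 x = 4}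
      ≤ #{v | v ≠ w ∧ ¬ H.Adj v w} := by
    rw [← Finset.card_union_of_disjoint]
    · apply Finset.card_le_card
      intro x; simp [SimpleGraph.adj_comm]; tauto
    · rw [Finset.disjoint_filter]; intros; omega
  have hε' : #{x | G.Adj u x ∧ dR G 2 x = 3} + #{x | G.Adj u x ∧ dR G 2 x = 4} ≤ dR G 2 u := by
    rw [← Finset.card_union_of_disjoint, dR_two G u]
    · apply Finset.card_le_card
      intro x; simp; tauto
    · rw [Finset.disjoint_filter]; intros; omega
  simp only [Nat.reduceAdd] at e3 e4 e5
  generalize #{x | dR G 2 x = 3} = a3 at *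
  generalize #{x | dR G 2 x = 4} = a4 at *
  generalize #{x | dR G 2 x = 5} = a5 at *
  generalize #{x | dR G 2 x = 6} = a6 at *
  push_cast at e3 e4 e5
  have b3 : a3 ≤ 1 := by
    by_contra hh
    have : (2:ℤ) ≤ a3 := by omega
    nlinarith
  have b4 : a4 ≤ 1 := by
    by_contra hh
    have : (2:ℤ) ≤ a4 := by omega
    nlinarith
  have b5 : a5 ≤ 1 := by
    by_contra hh
    have : (2:ℤ) ≤ a5 := by omega
    nlinarith
  have c3 : a3 = 0 ∨ a3 = 1 := by omega
  have c4 : a4 = 0 ∨ a4 = 1 := by omega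
  have c5 : a5 = 0 ∨ a5 = 1 := by omega
  clear hs e5
  rcases c3 with rfl | rfl <;> rcases c4 with rfl | rfl <;> rcases c5 with rfl | rfl <;>
    push_cast at e3 e4 <;> omega

lemma adj_of_full (G : SimpleGraph (Fin n)) (x : Fin n) (h : dR G 2 x + 1 = n) :
    ∀ y, y ≠ x → G.Adj x y := by
  intro y hy
  have h1 := nonadj_card G x
  have h2 : #{v | v ≠ x ∧ ¬ G.Adj v x} = 0 := by omega
  rw [Finset.card_eq_zero, Finset.filter_eq_empty_iff] at h2
  have := h2 (Finset.mem_univ y)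
  by_contra ha
  exact this ⟨hy, fun h' => ha h'.symm⟩

lemma adj_of_almost (G : SimpleGraph (Fin n)) (x p : Fin n) (h : dR G 2 x + 2 = n)
    (hp : p ≠ x) (hpx : ¬ G.Adj x p) : ∀ y, y ≠ x → y ≠ p → G.Adj x y := by
  intro y hy hyp
  have h1 := nonadj_card G x
  have h2 : #{v | v ≠ x ∧ ¬ G.Adj v x} = 1 := by omega
  rw [Finset.card_eq_one] at h2
  obtain ⟨a, ha⟩ := h2
  by_contra hxy
  have e1 : y ∈ ({a} : Finset (Fin n)) := by
    rw [← ha]; simp [hy]; exact fun h' => hxy h'.symm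
  have e2 : p ∈ ({a} : Finset (Fin n)) := by
    rw [← ha]; simp [hp]; exact fun h' => hpx h'.symm
  simp at e1 e2
  exact hyp (e1.trans e2.symm)

lemma caseA {G H : SimpleGraph (Fin n)} {u w : Fin n} {σ : Equiv.Perm (Fin n)}
    (h : Sh G H u w σ) (s D Δ : ℕ) (hD : 0 < D)
    (hd : ∀ v, dR H 2 (σ v) = dR G 2 v)
    (hc : ∀ v, dR H s (σ v) = dR G s v)
    (ht : ∀ v, v ≠ u → dR G (s + 1) v = dR H (s + 1) (σ v) + D)
    (hmax : ∀ v, dR G 2 v ≤ Δ) (hex : ∃ x, dR G 2 x = Δ) (hu : dR G 2 u ≠ Δ) : False := by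
  have hmaxH : ∀ y, dR H 2 y ≤ Δ := by
    intro y
    have := hd (σ.symm y)
    simp at this
    rw [this]; exact hmax _
  obtain ⟨x, hx, hxm⟩ := Finset.exists_max_image (univ.filter fun x => dR G 2 x = Δ)
    (fun x => dR G (s + 1) x) (by
      obtain ⟨x, hx⟩ := hex
      exact ⟨x, by simpa using hx⟩)
  simp only [mem_filter, mem_univ, true_and] at hx hxm
  have hxu : x ≠ u := by rintro rfl; exact hu hx
  have hadj : ∀ v, v ≠ u → v ≠ x → G.Adj v x := by
    intro v hv hvx
    by_contra ha
    obtain ⟨e, he, hcn, _⟩ := h.2 v hv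
    have h1 := hcn x hvx.symm
    have h2 := h1 2
    have h3 := h1 (s + 1)
    rw [cN_eq G _ v x hvx.symm ha] at h2 h3
    have h4 := cN_le H 2 (σ v) (e x)
    have h5 := cN_le H (s + 1) (σ v) (e x)
    have h6 := hmaxH (e x)
    have h7 := hd (σ.symm (e x))
    simp only [Equiv.apply_symm_apply] at h7
    have h8 : σ.symm (e x) ≠ u := by
      intro hh; apply hu; rw [← hh]; omega
    have h9 := ht _ h8
    simp only [Equiv.apply_symm_apply] at h9
    have := hxm _ (show dR G 2 (σ.symm (e x)) = Δ by omega)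
    omega
  obtain ⟨_, _, _, hk⟩ := h.2 x hxu
  by_cases hux : G.Adj u x
  · have hall : ∀ y, y ≠ x → G.Adj x y := by
      intro y hy
      by_cases hyu : y = u
      · subst hyu; exact hux.symm
      · exact (hadj y hyu hy).symm
    have hfull : dR G 2 x + 1 = n := by
      have h1 := nonadj_card G x
      have h2 : #{v | v ≠ x ∧ ¬ G.Adj v x} = 0 := by
        rw [Finset.card_eq_zero, Finset.filter_eq_empty_iff]
        rintro y _ ⟨h3, h4⟩
        exact h4 (hall y h3).symm
      omega
    have e1 := dR_dom G s x hall
    have e2 := dR_dom H s (σ x) (adj_of_full H (σ x) (by rw [hd]; exact hfull))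
    have := ht x hxu
    have := hk s
    omega
  · have hfull : dR G 2 x + 2 = n := by
      have h1 := nonadj_card G x
      have h2 : #{v | v ≠ x ∧ ¬ G.Adj v x} = 1 := by
        rw [Finset.card_eq_one]
        refine ⟨u, ?_⟩
        ext y
        simp
        constructor
        · rintro ⟨h3, h4⟩
          by_contra hyu
          exact h4 (hadj y hyu h3)
        · rintro rfl
          exact ⟨hxu.symm, hux⟩
      omega
    obtain ⟨⟨a, p⟩, hap, hapm⟩ := Finset.exists_max_image
      (univ.filter fun q : Fin n × Fin n => dR G 2 q.1 = Δ ∧ q.2 ≠ q.1 ∧ ¬ G.Adj q.1 q.2)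
      (fun q => dR G s q.2) ⟨(x, u), by
        simp [hx, hxu.symm]; exact fun h' => hux h'.symm⟩
    simp only [mem_filter, mem_univ, true_and, Prod.forall] at hap hapm
    obtain ⟨ha, hpa, hnap⟩ := hap
    have hau : a ≠ u := by rintro rfl; exact hu ha
    have e1 := dR_dom2 G s a p hpa hnap (adj_of_almost G a p (by omega) hpa hnap)
    obtain ⟨q, hqa, hnq⟩ : ∃ q, q ≠ σ a ∧ ¬ H.Adj (σ a) q := by
      have h1 := nonadj_card H (σ a)
      rw [hd] at h1
      have h2 : 0 < #{v | v ≠ σ a ∧ ¬ H.Adj v (σ a)} := by omega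
      rw [Finset.card_pos] at h2
      obtain ⟨q, hq⟩ := h2
      simp at hq
      exact ⟨q, hq.1, fun h' => hq.2 h'.symm⟩
    have e2 := dR_dom2 H s (σ a) q hqa hnq
      (adj_of_almost H (σ a) q (by rw [hd]; omega) hqa hnq)
    obtain ⟨_, _, _, hk'⟩ := h.2 a hau
    have e3 := hk' s
    have e4 := ht a hau
    obtain ⟨z, rfl⟩ := σ.surjective q
    have e5 := hc z
    by_cases hzu : z = u
    · have := hapm x u ⟨hx, hxu.symm, fun h' => hux h'.symm⟩
      rw [hzu] at e5 e2
      omega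
    · obtain ⟨e, he, hcn, _⟩ := h.2 z hzu
      obtain ⟨x2, hx2⟩ := e.surjective (σ a)
      have hx2z : x2 ≠ z := by
        rintro rfl; exact hqa (by rw [← he, hx2])
      have h1 := hcn x2 hx2z 2
      rw [hx2, cN_eq H 2 (σ z) (σ a) hqa.symm (fun h' => hnq h'.symm), hd, ha] at h1
      have h2 := hmax x2
      have h3 := cN_le G 2 z x2
      have h4 : ¬ G.Adj z x2 := by
        intro h'
        have := cN_adj G z x2 h'
        omega
      have := hapm x2 z ⟨by omega, hx2z.symm, fun h' => h4 h'.symm⟩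
      omega

lemma caseB_deg {G H : SimpleGraph (Fin n)} {u w : Fin n} {σ : Equiv.Perm (Fin n)}
    (hn : 7 ≤ n) (h : Sh G H u w σ) (r D Δ : ℕ) (hD : 0 < D)
    (hd : ∀ v, dR H 2 (σ v) = dR G 2 v)
    (ht : ∀ v, v ≠ u → dR G r v = dR H r (σ v) + D)
    (hu : dR G 2 u = Δ)
    (hs : 4 * ∑ v, dR G 2 v ≤ n * (n - 4)) : 4 * Δ + 8 ≤ 3 * n := by
  have core : ∀ d1, d1 ≠ Δ → (∃ x, dR G 2 x = d1) → ∃ x, dR G 2 x = d1 ∧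
      ∀ v, v ≠ u → v ≠ x → ¬ G.Adj v x → ∃ y, H.Adj (σ v) y ∧ dR H 2 y = d1 + 1 := by
    rintro d1 hd1 ⟨x0, hx0⟩
    obtain ⟨x, hx, hxm⟩ := Finset.exists_max_image (univ.filter fun x => dR G 2 x = d1)
      (fun x => dR G r x) ⟨x0, by simpa using hx0⟩
    simp only [mem_filter, mem_univ, true_and] at hx hxm
    refine ⟨x, hx, ?_⟩
    intro v hv hvx ha
    obtain ⟨e, he, hcn, _⟩ := h.2 v hv
    have h1 := hcn x hvx.symm
    have h2 := h1 2
    have h3 := h1 r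
    rw [cN_eq G _ v x hvx.symm ha] at h2 h3
    have hne : e x ≠ σ v := by
      rw [← he]; exact fun hh => hvx (e.injective hh).symm
    have hadj : H.Adj (σ v) (e x) := by
      by_contra hna
      rw [cN_eq H _ _ _ hne hna] at h2 h3
      obtain ⟨z, hz⟩ := σ.surjective (e x)
      rw [← hz] at h2 h3
      have h7 := hd z
      have h8 : z ≠ u := by
        rintro rfl; omega
      have h9 := ht _ h8
      have := hxm z (by omega)
      omega
    refine ⟨e x, hadj, ?_⟩
    have := cN_adj H _ _ hadj
    omega
  have hlt : Δ + 1 ≤ n := by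
    have := nonadj_card G u
    omega
  have step : ∀ d1, d1 < Δ → (∃ x, dR G 2 x = d1) → ∃ x, dR G 2 x = d1 + 1 := by
    intro d1 hd1 hex
    by_cases hh : d1 + 1 = Δ
    · exact ⟨u, by omega⟩
    · obtain ⟨x, hx, hc⟩ := core d1 (by omega) hex
      have h1 := nonadj_card G x
      have h2 : 1 < #{v | v ≠ x ∧ ¬ G.Adj v x} := by omega
      obtain ⟨v, hv, hvu⟩ := Finset.exists_mem_ne h2 u
      simp only [mem_filter, mem_univ, true_and] at hv
      obtain ⟨y, _, hy⟩ := hc v hvu hv.1 hv.2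
      obtain ⟨z, rfl⟩ := σ.surjective y
      exact ⟨z, by rw [← hd, hy]⟩
  obtain ⟨v, _, hv⟩ := Finset.exists_min_image (univ : Finset (Fin n)) (fun x => dR G 2 x) ⟨u, by simp⟩
  have hδ : 4 * dR G 2 v ≤ n - 4 := by
    have h1 : n * dR G 2 v ≤ ∑ x, dR G 2 x := by
      have := Finset.card_nsmul_le_sum univ (fun x => dR G 2 x) (dR G 2 v) hv
      simpa using this
    refine Nat.le_of_mul_le_mul_left (c := n) ?_ (by omega)
    nlinarith
  have occ : ∀ k, dR G 2 v ≤ k → k ≤ Δ → ∃ x, dR G 2 x = k := by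
    intro k hk
    induction k, hk using Nat.le_induction with
    | base => intro _; exact ⟨v, rfl⟩
    | succ k hk ih => intro hk2; exact step k (by omega) (ih (by omega))
  by_cases hvΔ : dR G 2 v = Δ
  · omega
  have hvu : v ≠ u := by rintro rfl; exact hvΔ hu
  have hsub : Finset.Ioo (dR G 2 v) Δ ⊆
      ({y | G.Adj v y} : Finset (Fin n)).image (fun y => dR G 2 y) ∪
      ({y | H.Adj (σ v) y} : Finset (Fin n)).image (fun y => dR H 2 y - 1) := by
    intro k hk
    simp only [Finset.mem_Ioo] at hk
    obtain ⟨x, hx, hc⟩ := core k (by omega) (occ k (by omega) (by omega))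
    simp only [mem_union, mem_image, mem_filter, mem_univ, true_and]
    by_cases ha : G.Adj v x
    · exact Or.inl ⟨x, ha, hx⟩
    · obtain ⟨y, hy1, hy2⟩ := hc v hvu (by rintro rfl; omega) ha
      exact Or.inr ⟨y, hy1, by omega⟩
  have hc := (Finset.card_le_card hsub).trans (Finset.card_union_le _ _)
  have i1 := Finset.card_image_le (s := ({y | G.Adj v y} : Finset (Fin n))) (f := fun y => dR G 2 y)
  have i2 := Finset.card_image_le (s := ({y | H.Adj (σ v) y} : Finset (Fin n)))
    (f := fun y => dR H 2 y - 1)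
  rw [← dR_two] at i1 i2
  rw [Nat.card_Ioo] at hc
  have := hd v
  omega

/-- number of top vertices with property `P` -/
noncomputable def aP (G : SimpleGraph (Fin n)) (r Δ : ℕ) (P : ℕ → Prop) : ℕ :=
  #{x | dR G 2 x = Δ ∧ P (dR G r x)}

/-- number of top non-neighbours of `v` with property `P` -/
noncomputable def mP (G : SimpleGraph (Fin n)) (r Δ : ℕ) (P : ℕ → Prop) (v : Fin n) : ℕ :=
  #{x | x ≠ v ∧ ¬ G.Adj v x ∧ dR G 2 x = Δ ∧ P (dR G r x)}

lemma mP_eq (G : SimpleGraph (Fin n)) (r Δ : ℕ) (P : ℕ → Prop) (v : Fin n)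
    (hmax : ∀ v, dR G 2 v ≤ Δ) :
    mP G r Δ P v = #{x | x ≠ v ∧ (cN G 2 v x = Δ ∧ P (cN G r v x))} := by
  unfold mP
  congr 1
  ext x
  simp only [mem_filter, mem_univ, true_and]
  by_cases hx : x = v
  · simp [hx]
  by_cases ha : G.Adj v x
  · have := cN_adj G v x ha
    have := hmax x
    have : cN G 2 v x ≠ Δ := by omega
    simp [ha, this]
  · simp [hx, ha, cN_eq G _ v x hx ha]

lemma mP_sum (G : SimpleGraph (Fin n)) (r Δ : ℕ) (P : ℕ → Prop) :
    ∑ v, mP G r Δ P v = (n - 1 - Δ) * aP G r Δ P := by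
  unfold mP aP
  simp_rw [Finset.card_filter]
  rw [Finset.sum_comm, Finset.mul_sum]
  apply Finset.sum_congr rfl
  intro x _
  by_cases h : dR G 2 x = Δ ∧ P (dR G r x)
  · have h1 := nonadj_card G x
    have h2 : #{v | v ≠ x ∧ ¬ G.Adj v x} = n - 1 - Δ := by omega
    rw [Finset.card_filter] at h2
    simp only [h, and_true, if_true, mul_one, and_self]
    rw [← h2]
    apply Finset.sum_congr rfl
    intro v _
    simp [ne_comm]
  · simp [h]

lemma mP_le (G : SimpleGraph (Fin n)) (r Δ : ℕ) (P : ℕ → Prop) (v : Fin n) (hv : dR G 2 v = Δ) :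
    mP G r Δ P v ≤ n - 1 - Δ := by
  have h1 := nonadj_card G v
  have : mP G r Δ P v ≤ #{x | x ≠ v ∧ ¬ G.Adj x v} := by
    apply Finset.card_le_card
    intro x
    simp only [mem_filter, mem_univ, true_and]
    rintro ⟨a, b, _⟩
    exact ⟨a, fun h' => b h'.symm⟩
  omega

lemma mP_le_aP (G : SimpleGraph (Fin n)) (r Δ : ℕ) (P : ℕ → Prop) (v : Fin n) :
    mP G r Δ P v ≤ aP G r Δ P := by
  apply Finset.card_le_card
  intro x
  simp only [mem_filter, mem_univ, true_and]
  tauto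

lemma mP_mono (G : SimpleGraph (Fin n)) (r Δ : ℕ) (P : ℕ → Prop) (v : Fin n) :
    mP G r Δ P v ≤ mP G r Δ (fun _ => True) v := by
  apply Finset.card_le_card
  intro x
  simp only [mem_filter, mem_univ, true_and]
  tauto

lemma mP_split (G : SimpleGraph (Fin n)) (r Δ : ℕ) (P : ℕ → Prop) (v : Fin n) :
    mP G r Δ (fun _ => True) v = mP G r Δ P v + mP G r Δ (fun k => ¬ P k) v := by
  unfold mP
  rw [← Finset.card_filter_add_card_filter_not (p := fun x => P (dR G r x)),
    filter_filter, filter_filter]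
  congr 2 <;> (ext x; simp only [mem_filter, mem_univ, true_and]; tauto)

lemma aP_split (G : SimpleGraph (Fin n)) (r Δ : ℕ) (P : ℕ → Prop) :
    aP G r Δ (fun _ => True) = aP G r Δ P + aP G r Δ (fun k => ¬ P k) := by
  unfold aP
  rw [← Finset.card_filter_add_card_filter_not (p := fun x => P (dR G r x)),
    filter_filter, filter_filter]
  congr 2 <;> (ext x; simp only [mem_filter, mem_univ, true_and]; tauto)

lemma aP_le (G : SimpleGraph (Fin n)) (r Δ : ℕ) (P : ℕ → Prop) (v : Fin n) :
    aP G r Δ P ≤ dR G 2 v + 1 + mP G r Δ P v := by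
  have h1 : dR G 2 v + 1 = #(insert v ({y | G.Adj v y} : Finset (Fin n))) := by
    rw [Finset.card_insert_of_notMem (by simp), dR_two]
  rw [h1]
  refine le_trans (Finset.card_le_card ?_) (Finset.card_union_le _ _)
  intro x
  simp only [mem_filter, mem_univ, true_and, mem_union, mem_insert]
  tauto

lemma aP_mul_le (G : SimpleGraph (Fin n)) (r Δ : ℕ) (P : ℕ → Prop) :
    aP G r Δ P * Δ ≤ ∑ v, dR G 2 v := by
  unfold aP
  calc _ ≤ ∑ v ∈ ({x | dR G 2 x = Δ ∧ P (dR G r x)} : Finset (Fin n)), dR G 2 v := by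
        have := Finset.card_nsmul_le_sum ({x | dR G 2 x = Δ ∧ P (dR G r x)} : Finset (Fin n))
          (fun v => dR G 2 v) Δ (by intro x; simp; intro h _; omega)
        simpa using this
    _ ≤ _ := Finset.sum_le_sum_of_subset (Finset.subset_univ _)

lemma caseB_main {G H : SimpleGraph (Fin n)} {u w : Fin n} {σ : Equiv.Perm (Fin n)}
    (h : Sh G H u w σ) (r Δ : ℕ) (P : ℕ → Prop)
    (hd : ∀ v, dR H 2 (σ v) = dR G 2 v) (hmax : ∀ v, dR G 2 v ≤ Δ) :
    (n - 1 - Δ) * aP G r Δ P + mP H r Δ P w = (n - 1 - Δ) * aP H r Δ P + mP G r Δ P u := by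
  have hmaxH : ∀ y, dR H 2 y ≤ Δ := by
    intro y
    obtain ⟨z, rfl⟩ := σ.surjective y
    rw [hd]; exact hmax _
  rw [← mP_sum, ← mP_sum]
  apply h.sum_count
  intro v hv
  rw [mP_eq _ _ _ _ _ hmax, mP_eq _ _ _ _ _ hmaxH]
  have := h.count r (fun a b => a = Δ ∧ P b) v hv
  convert this

lemma arithB (m N Δ : ℕ) (hm : 3 ≤ m) (g2 : N ≤ Δ + 2) (g3 : N + Δ + 1 = m + 4)
    (g4 : 4 * Δ ≤ 3 * m + 4) (g6 : 4 * (2 * N) * Δ ≤ (m + 4) * m + 4 * Δ) : False := by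
  zify at *
  have e : (N : ℤ) = m + 3 - Δ := by linarith
  rw [e] at g6 g2
  nlinarith [mul_nonneg (show (0:ℤ) ≤ 2 * Δ - m - 1 by linarith)
    (show (0:ℤ) ≤ 3 * m + 4 - 4 * Δ by linarith)]

lemma caseB_le {G H : SimpleGraph (Fin n)} {u w : Fin n} {σ : Equiv.Perm (Fin n)}
    (hn : 7 ≤ n) (h : Sh G H u w σ) (r Δ : ℕ) (P : ℕ → Prop)
    (hd : ∀ v, dR H 2 (σ v) = dR G 2 v) (hmax : ∀ v, dR G 2 v ≤ Δ) (hu : dR G 2 u = Δ)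
    (hs : 4 * ∑ v, dR H 2 v ≤ n * (n - 4)) (hΔ : 4 * Δ + 8 ≤ 3 * n) :
    aP G r Δ P ≤ aP H r Δ P := by
  by_contra hlt
  push Not at hlt
  have hw : dR H 2 w = Δ := by rw [← h.1, hd, hu]
  have e1 := caseB_main h r Δ P hd hmax
  have e2 := caseB_main h r Δ (fun _ => True) hd hmax
  have hl : aP G r Δ (fun _ => True) = aP H r Δ (fun _ => True) := by
    unfold aP
    apply Finset.card_equiv σ
    intro x
    simp [hd]
  have b1 := mP_le G r Δ P u hu
  have b2 := mP_le G r Δ (fun _ => True) u hu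
  have b3 := mP_mono G r Δ P u
  have b4 := mP_split H r Δ P w
  have b5 := aP_split H r Δ P
  have b6 := mP_le_aP H r Δ (fun k => ¬ P k) w
  have b7 := mP_le_aP G r Δ P u
  have b8 := aP_le H r Δ P w
  have b9 := aP_mul_le H r Δ (fun _ => True)
  rw [hl] at e2
  obtain ⟨N, hN⟩ : ∃ N, n - 1 - Δ = N := ⟨_, rfl⟩
  rw [hN] at e1 e2 b1 b2
  have c1 : mP G r Δ P u = N ∧ mP H r Δ P w = 0 ∧ aP G r Δ P = aP H r Δ P + 1 := by
    obtain ⟨k, hk⟩ := Nat.exists_eq_add_of_lt hlt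
    rw [hk] at e1
    have : N * (aP H r Δ P + k + 1) = N * aP H r Δ P + N * k + N := by ring
    have hk0 : N * k = 0 := by omega
    have : k = 0 := by
      rcases Nat.mul_eq_zero.1 hk0 with h' | h'
      · omega
      · exact h'
    omega
  obtain ⟨c1, c2, c3⟩ := c1
  have g1 : 2 * N ≤ aP H r Δ (fun _ => True) + 1 := by omega
  have g2 : N ≤ Δ + 2 := by omega
  generalize aP H r Δ (fun _ => True) = l at *
  obtain ⟨m, rfl⟩ : ∃ m, n = m + 4 := ⟨n - 4, by omega⟩
  have g3 : N + Δ + 1 = m + 4 := by omega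
  have g4 : 4 * (l * Δ) ≤ (m + 4) * m := by
    simp at hs; omega
  have g5 : (2 * N) * Δ ≤ (l + 1) * Δ := Nat.mul_le_mul_right _ g1
  have g6 : 4 * (2 * N) * Δ ≤ (m + 4) * m + 4 * Δ := by nlinarith
  exact arithB m N Δ (by omega) g2 g3 (by omega) g6

lemma arithC (n r m : ℕ) (hn : 7 ≤ n) (hr : 4 * r ≤ n) (hm : m + 1 + r = n)
    (h : 4 * ((m + 1) * m) ≤ n * (n - 4)) : False := by
  obtain ⟨k, rfl⟩ : ∃ k, n = k + 4 := ⟨n - 4, by omega⟩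
  simp only [Nat.add_sub_cancel] at h
  have h1 : 3 * (k + 4) ≤ 4 * (m + 1) := by omega
  nlinarith

lemma mP_zero (G : SimpleGraph (Fin n)) (r Δ : ℕ) (P : ℕ → Prop) (v : Fin n) :
    mP G r Δ P v = 0 ↔ ∀ x, ¬ (x ≠ v ∧ ¬ G.Adj v x ∧ dR G 2 x = Δ ∧ P (dR G r x)) := by
  unfold mP
  rw [Finset.card_eq_zero, Finset.filter_eq_empty_iff]
  simp only [mem_univ, true_implies]

lemma aP_zero (G : SimpleGraph (Fin n)) (r Δ : ℕ) (P : ℕ → Prop)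
    (h : ∀ x, ¬ (dR G 2 x = Δ ∧ P (dR G r x))) : aP G r Δ P = 0 := by
  unfold aP
  rw [Finset.card_eq_zero, Finset.filter_eq_empty_iff]
  exact fun x _ => h x

lemma mP_single (G : SimpleGraph (Fin n)) (r Δ k : ℕ) (a : Fin n)
    (ha : ∀ x, dR G 2 x = Δ ∧ dR G r x = k ↔ x = a) (v : Fin n) :
    mP G r Δ (fun j => j = k) v = 0 ↔ (a = v ∨ G.Adj v a) := by
  rw [mP_zero]
  simp only [ha]
  constructor
  · intro h
    have := h a
    tauto
  · rintro h x ⟨h1, h2, rfl⟩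
    tauto

lemma caseB {G H : SimpleGraph (Fin n)} {u w : Fin n} {σ : Equiv.Perm (Fin n)}
    (hn : 7 ≤ n) (h : Sh G H u w σ) (r D Δ m : ℕ) (hD : 0 < D) (hr : 4 * r ≤ n)
    (hm : m + 1 + r = n)
    (hd : ∀ v, dR H 2 (σ v) = dR G 2 v)
    (ht : ∀ v, v ≠ u → dR G r v = dR H r (σ v) + D)
    (htw : dR H r w = dR G r u + m * D)
    (hmax : ∀ v, dR G 2 v ≤ Δ) (hu : dR G 2 u = Δ)
    (hs : 4 * ∑ v, dR G 2 v ≤ n * (n - 4))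
    (hs' : 4 * ∑ v, dR H 2 v ≤ n * (n - 4)) : False := by
  have hΔ := caseB_deg hn h r D Δ hD hd ht hu hs
  have hmaxH : ∀ y, dR H 2 y ≤ Δ := by
    intro y
    obtain ⟨z, rfl⟩ := σ.surjective y
    rw [hd]; exact hmax _
  have hw : dR H 2 w = Δ := by rw [← h.1, hd, hu]
  have haP : ∀ P, aP G r Δ P = aP H r Δ P := fun P => le_antisymm
    (caseB_le hn h r Δ P hd hmax hu hs' hΔ)
    (caseB_le hn h.symm r Δ P (fun v => by rw [← hd, Equiv.apply_symm_apply]) hmaxH hw hs hΔ)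
  have hmP : ∀ P v, mP G r Δ P v = mP H r Δ P (σ v) := by
    intro P v
    by_cases hv : v = u
    · have := caseB_main h r Δ P hd hmax
      rw [haP] at this
      rw [hv, h.1]
      omega
    · rw [mP_eq _ _ _ _ _ hmax, mP_eq _ _ _ _ _ hmaxH]
      have := h.count r (fun a b => a = Δ ∧ P b) v hv
      convert this
  set t0 := dR G r u with ht0
  have hrec : ∀ i, aP G r Δ (fun j => j = t0 + i * D)
      = aP G r Δ (fun j => j = t0 + (i + 1) * D) + if i = m then 1 else 0 := by
    intro i
    have h1 : aP H r Δ (fun j => j = t0 + i * D)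
        = #{x | dR G 2 x = Δ ∧ dR H r (σ x) = t0 + i * D} := by
      symm
      unfold aP
      apply Finset.card_equiv σ
      intro x
      simp [hd]
    rw [haP, h1]
    unfold aP
    have hmul : (i + 1) * D = i * D + D := by ring
    have hx : ∀ x, x ≠ u → (dR H r (σ x) = t0 + i * D ↔ dR G r x = t0 + (i + 1) * D) := by
      intro x hx
      have := ht x hx
      omega
    by_cases him : i = m
    · simp only [him, if_true]
      rw [← him]
      rw [← Finset.card_insert_of_notMem (a := u)]
      · congr 1
        ext x
        simp only [mem_filter, mem_univ, true_and, mem_insert]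
        by_cases hxu : x = u
        · subst hxu
          simp only [hu, h.1, htw, him, true_or, and_self]
        · simp only [hxu, false_or, hx x hxu]
      · simp only [mem_filter, mem_univ, true_and, not_and]
        intro _
        omega
    · simp only [him, if_false, add_zero]
      congr 1
      ext x
      simp only [mem_filter, mem_univ, true_and]
      by_cases hxu : x = u
      · subst hxu
        have : i * D ≠ m * D := fun hh => him (Nat.eq_of_mul_eq_mul_right hD hh)
        rw [h.1, htw]
        omega
      · rw [hx x hxu]
  have hzero : aP G r Δ (fun j => j = t0 + (m + 1) * D) = 0 := by
    have hc : ∀ j, aP G r Δ (fun j => j = t0 + (m + 1) * D)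
        = aP G r Δ (fun k => k = t0 + (m + 1 + j) * D) := by
      intro j
      induction j with
      | zero => rfl
      | succ j ih =>
        rw [ih, hrec, if_neg (by omega)]
        rfl
    rw [hc (∑ x, dR G r x)]
    apply aP_zero
    rintro x ⟨_, hx⟩
    have h1 : dR G r x ≤ ∑ x, dR G r x :=
      Finset.single_le_sum (f := fun x => dR G r x) (fun _ _ => Nat.zero_le _) (mem_univ x)
    have h2 : m + 1 + ∑ x, dR G r x ≤ (m + 1 + ∑ x, dR G r x) * D := Nat.le_mul_of_pos_right _ hD
    omega
  have hone : ∀ j, j ≤ m → aP G r Δ (fun k => k = t0 + (m - j) * D) = 1 := by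
    intro j
    induction j with
    | zero =>
      intro _
      rw [Nat.sub_zero, hrec, hzero]
      simp
    | succ j ih =>
      intro hj
      rw [hrec, if_neg (by omega), show m - (j + 1) + 1 = m - j by omega, ih (by omega)]
  have hone' : ∀ i, i ≤ m → aP G r Δ (fun k => k = t0 + i * D) = 1 := by
    intro i hi
    have := hone (m - i) (by omega)
    rwa [show m - (m - i) = i by omega] at this
  have hexa : ∀ i, ∃ a, i ≤ m → ∀ x, dR G 2 x = Δ ∧ dR G r x = t0 + i * D ↔ x = a := by
    intro i
    by_cases hi : i ≤ m
    · have h1 := hone' i hi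
      unfold aP at h1
      rw [Finset.card_eq_one] at h1
      obtain ⟨a, ha⟩ := h1
      refine ⟨a, fun _ x => ?_⟩
      have := congrArg (fun s => x ∈ s) ha
      simpa using this
    · exact ⟨u, fun hh => absurd hh hi⟩
  choose a ha using hexa
  have haval : ∀ i, i ≤ m → dR G 2 (a i) = Δ ∧ dR G r (a i) = t0 + i * D :=
    fun i hi => (ha i hi (a i)).2 rfl
  have hb : ∀ i, i < m → ∀ y, dR H 2 y = Δ ∧ dR H r y = t0 + i * D ↔ y = σ (a (i + 1)) := by
    intro i hi
    have hmul : (i + 1) * D = i * D + D := by ring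
    have h1 := hone' i (by omega)
    rw [haP] at h1
    unfold aP at h1
    rw [Finset.card_eq_one] at h1
    obtain ⟨b, hb⟩ := h1
    have hb' : ∀ y, dR H 2 y = Δ ∧ dR H r y = t0 + i * D ↔ y = b := by
      intro y
      have := congrArg (fun s => y ∈ s) hb
      simpa using this
    have h2 := haval (i + 1) (by omega)
    have h3 : a (i + 1) ≠ u := by
      intro hh
      rw [hh] at h2
      omega
    have h4 := ht _ h3
    have h5 := hd (a (i + 1))
    have h6 := (hb' (σ (a (i + 1)))).1 ⟨by omega, by omega⟩
    rw [h6]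
    exact hb'
  have key : ∀ p q, p < m → q < m →
      ((a p = a (q + 1) ∨ G.Adj (a (q + 1)) (a p)) ↔
        (σ (a (p + 1)) = σ (a (q + 1)) ∨ H.Adj (σ (a (q + 1))) (σ (a (p + 1))))) := by
    intro p q hp hq
    rw [← mP_single G r Δ (t0 + p * D) (a p) (ha p hp.le), hmP,
      mP_single H r Δ (t0 + p * D) (σ (a (p + 1))) (hb p hp)]
  have key2 : ∀ p q, p < m → q < m →
      (a p = a (q + 1) ∨ G.Adj (a (q + 1)) (a p)) → (a q = a (p + 1) ∨ G.Adj (a (p + 1)) (a q)) := by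
    intro p q hp hq h1
    rw [key q p hq hp]
    rw [key p q hp hq] at h1
    rcases h1 with h1 | h1
    · exact Or.inl h1.symm
    · exact Or.inr h1.symm
  have hcl : ∀ j, ∀ p, p + j ≤ m → (a p = a (p + j) ∨ G.Adj (a (p + j)) (a p)) := by
    intro j
    induction j using Nat.twoStepInduction with
    | zero => intro p _; exact Or.inl rfl
    | one => intro p hp; rw [key p p (by omega) (by omega)]; exact Or.inl rfl
    | more j ih _ =>
      intro p hp
      have h1 := ih (p + 1) (by omega)
      apply key2 (p + j + 1) p (by omega) (by omega) |> fun f => ?_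
      have h2 : a (p + j + 1) = a (p + 1) ∨ G.Adj (a (p + 1)) (a (p + j + 1)) := by
        rw [show p + 1 + j = p + j + 1 by ring] at h1
        rcases h1 with h1 | h1
        · exact Or.inl h1.symm
        · exact Or.inr h1.symm
      exact f h2
  have hinj : Set.InjOn a (Finset.range (m + 1) : Set ℕ) := by
    intro i hi j hj hij
    simp at hi hj
    have h1 := haval i (by omega)
    have h2 := haval j (by omega)
    rw [hij] at h1
    exact Nat.eq_of_mul_eq_mul_right hD (by omega)
  have hcard : #((Finset.range (m + 1)).image a) = m + 1 := by
    rw [Finset.card_image_of_injOn hinj, Finset.card_range]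
  have hd1 : m + 1 ≤ Δ + 1 := by
    have h1 : Δ + 1 = #(insert (a 0) ({y | G.Adj (a 0) y} : Finset (Fin n))) := by
      rw [Finset.card_insert_of_notMem (by simp), ← dR_two, (haval 0 (by omega)).1]
    rw [h1, ← hcard]
    apply Finset.card_le_card
    intro x
    simp only [mem_image, mem_range, mem_insert, mem_filter, mem_univ, true_and]
    rintro ⟨i, hi, rfl⟩
    have := hcl i 0 (by omega)
    rw [zero_add] at this
    rcases this with h1 | h1
    · exact Or.inl h1.symm
    · exact Or.inr h1.symm
  have hl : m + 1 ≤ aP G r Δ (fun _ => True) := by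
    rw [← hcard]
    apply Finset.card_le_card
    intro x
    simp only [mem_image, mem_range, mem_filter, mem_univ, true_and, and_true]
    rintro ⟨i, hi, rfl⟩
    exact (haval i (by omega)).1
  have h1 := aP_mul_le G r Δ (fun _ => True)
  have h2 : (m + 1) * m ≤ aP G r Δ (fun _ => True) * Δ := Nat.mul_le_mul hl (by omega)
  exact arithC n r m hn hr hm (by omega)

lemma kp_one (G : SimpleGraph (Fin n)) : kp G 1 = n := by
  have h1 : ∀ x, dR G 1 x = 1 := by
    intro x
    unfold dR
    rw [Finset.card_eq_one]
    refine ⟨{x}, ?_⟩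
    ext s
    simp only [mem_filter, mem_univ, true_and, mem_singleton]
    constructor
    · rintro ⟨h2, h3⟩
      obtain ⟨y, rfl⟩ := Finset.card_eq_one.1 h2.card_eq
      simp at h3
      rw [h3]
    · rintro rfl
      simp [SimpleGraph.isNClique_iff]
  have := sum_dR G 1
  simp [h1] at this
  omega

lemma dR_two_lt (G : SimpleGraph (Fin n)) (x : Fin n) : dR G 2 x + 1 ≤ n := by
  have := nonadj_card G x
  omega

lemma kp_two {G H : SimpleGraph (Fin n)} {u w : Fin n} {σ : Equiv.Perm (Fin n)}
    (hn : 7 ≤ n) (h : Sh G H u w σ) (hs : 4 * ∑ v, dR G 2 v ≤ n * (n - 4)) :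
    kp G 2 = kp H 2 := by
  have h1 := h.shift_u 2
  have h2 := dR_two_lt G u
  have h3 := dR_two_lt H w
  have e1 := sum_dR G 2
  have e2 := sum_dR H 2
  obtain ⟨D, hD⟩ : ∃ D : ℤ, (kp G 2 : ℤ) - kp H 2 = D := ⟨_, rfl⟩
  rw [hD] at h1
  push_cast at h1
  have hlt : D < 2 := by
    by_contra hc
    push Not at hc
    have : ((n : ℤ) - 1 - 2) * 2 ≤ (n - 1 - 2) * D := by
      apply mul_le_mul_of_nonneg_left hc; omega
    omega
  have hgt : -2 < D := by
    by_contra hc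
    push Not at hc
    have : ((n : ℤ) - 1 - 2) * D ≤ (n - 1 - 2) * (-2) := by
      apply mul_le_mul_of_nonneg_left hc; omega
    omega
  rcases (show D = -1 ∨ D = 0 ∨ D = 1 by omega) with hh | hh | hh
  · exact (edge_case hn h.symm (by omega) hs).elim
  · omega
  · exact (edge_case hn h (by omega) (by omega)).elim

lemma kp_step_lt {G H : SimpleGraph (Fin n)} {u w : Fin n} {σ : Equiv.Perm (Fin n)}
    (hn : 7 ≤ n) (h : Sh G H u w σ) (hs : 4 * ∑ v, dR G 2 v ≤ n * (n - 4))
    (s : ℕ) (h2 : kp G 2 = kp H 2) (hks : kp G s = kp H s) :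
    kp G (s + 1) ≤ kp H (s + 1) := by
  by_contra hlt
  push Not at hlt
  have heq : ∀ q, kp G q = kp H q → ∀ v, dR H q (σ v) = dR G q v := by
    intro q hq v
    by_cases hv : v = u
    · have := h.shift_u q
      rw [hq, sub_self, mul_zero] at this
      rw [hv, h.1]; omega
    · have := h.shift q v hv
      omega
  obtain ⟨D, hD⟩ : ∃ D, kp G (s + 1) = kp H (s + 1) + D := ⟨_, (Nat.add_sub_cancel' hlt.le).symm⟩
  have hD0 : 0 < D := by omega
  have ht : ∀ v, v ≠ u → dR G (s + 1) v = dR H (s + 1) (σ v) + D := by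
    intro v hv
    have := h.shift (s + 1) v hv
    omega
  have hd := heq 2 h2
  obtain ⟨z, _, hz⟩ := Finset.exists_max_image (univ : Finset (Fin n)) (fun x => dR G 2 x) ⟨u, by simp⟩
  have hz' : ∀ v, dR G 2 v ≤ dR G 2 z := fun v => hz v (mem_univ v)
  by_cases hu : dR G 2 u = dR G 2 z
  · have hpos : ∀ v, v ≠ u → s ≤ dR G 2 v := by
      intro v hv
      have := dR_pos_deg G (s + 1) v (by have := ht v hv; omega)
      omega
    have hpos' : ∀ v, s ≤ dR G 2 v := by
      intro v
      by_cases hv : v = u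
      · obtain ⟨v', hv'⟩ : ∃ v' : Fin n, v' ≠ u := by
          have : Nontrivial (Fin n) := Fin.nontrivial_iff_two_le.2 (by omega)
          exact exists_ne u
        have := hpos v' hv'
        have := hz' v'
        rw [hv]; omega
      · exact hpos v hv
    have hn4 : 4 * s ≤ n - 4 := by
      have h1 : n * s ≤ ∑ x, dR G 2 x := by
        have := Finset.card_nsmul_le_sum univ (fun x => dR G 2 x) s (fun x _ => hpos' x)
        simpa using this
      refine Nat.le_of_mul_le_mul_left (c := n) ?_ (by omega)
      nlinarith
    obtain ⟨m, hm⟩ : ∃ m, m + 1 + (s + 1) = n := ⟨n - 2 - s, by omega⟩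
    refine caseB hn h (s + 1) D (dR G 2 z) m hD0 (by omega) hm hd ht ?_ hz' hu hs ?_
    · have h1 := h.shift_u (s + 1)
      have e1 : (n : ℤ) - 1 - ((s + 1 : ℕ) : ℤ) = m := by omega
      have e2 : (kp G (s + 1) : ℤ) - kp H (s + 1) = D := by omega
      rw [e1, e2] at h1
      zify
      linarith
    · rw [sum_dR, ← h2, ← sum_dR]; exact hs
  · exact caseA h s D (dR G 2 z) hD0 hd (heq s hks) ht hz' ⟨z, rfl⟩ hu

lemma kp_all {G H : SimpleGraph (Fin n)} {u w : Fin n} {σ : Equiv.Perm (Fin n)}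
    (hn : 7 ≤ n) (h : Sh G H u w σ) (hs : 4 * ∑ v, dR G 2 v ≤ n * (n - 4)) (r : ℕ) (hr : 1 ≤ r) :
    kp G r = kp H r := by
  have h2 := kp_two hn h hs
  have hs' : 4 * ∑ v, dR H 2 v ≤ n * (n - 4) := by
    rw [sum_dR, ← h2, ← sum_dR]; exact hs
  by_cases hr1 : r = 1
  · subst hr1; rw [kp_one, kp_one]
  have hr2 : 2 ≤ r := by omega
  clear hr hr1
  induction r, hr2 using Nat.le_induction with
  | base => exact h2
  | succ s hs2 ih =>
    exact le_antisymm (kp_step_lt hn h hs s h2 ih)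
      (kp_step_lt hn h.symm hs' s h2.symm ih.symm)

end CliqueCount

theorem clique_count_of_sparse {n : ℕ} (hn : 7 ≤ n)
    (G H : SimpleGraph (Fin n)) (hshare : ShareCards G H)
    (hsparse : 4 * ∑ v : Fin n, deg G v ≤ n * (n - 4)) :
    ∀ r : ℕ, 1 ≤ r → kappa G r = kappa H r := by
  intro r hr
  obtain ⟨u, w, σ, h⟩ := sh_of_shareCards G H hshare
  rw [kappa_eq, kappa_eq]
  refine kp_all hn h ?_ r hr
  simpa only [deg_eq] using hsparse
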